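/- Let x = (α, A⁽¹⁾, …, A⁽ᵛ⁾, S) ∈ G be a feasible point such that S_pq < 0 for at least one entry (p,q). Define S̃ ∈ ℝ^{n×n} by setting every negative entry of S to 0 and keeping all other entries unchanged. Then f(α, A⁽¹⁾, …, A⁽ᵛ⁾, S̃) < f(α, A⁽¹⁾, …, A⁽ᵛ⁾, S). -/

import Mathlib

/-- The objective function `f(α, A⁽¹⁾, …, A⁽ᵛ⁾, S)` of the consistent graph
learning problem, with `B i i = β` and `B i l = γ` for `i ≠ l`. -/
noncomputable def objf (n v : ℕ) (W : Fin v → Matrix (Fin n) (Fin n) ℝ)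
    (lam : Fin v → ℝ) (β γ : ℝ)
    (α : Fin v → ℝ) (A : Fin v → Matrix (Fin n) (Fin n) ℝ)
    (S : Matrix (Fin n) (Fin n) ℝ) : ℝ :=
  (∑ i, lam i * ∑ j, ∑ k, (α i * A i j k - S j k) ^ 2)
    + ∑ i, ∑ l, (if i = l then β else γ) * lam i * lam l * α i * α l *
        ∑ j, ∑ k, (W i j k - A i j k) * (W l j k - A l j k)

/-- Feasibility of `(α, A⁽¹⁾, …, A⁽ᵛ⁾)`: `α` lies in the simplex `G₀`
and each `A⁽ⁱ⁾` satisfies `0 ≤ A⁽ⁱ⁾ ≤ W⁽ⁱ⁾` entrywise (the sets `Gᵢ`). -/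
def feasible (n v : ℕ) (W : Fin v → Matrix (Fin n) (Fin n) ℝ)
    (α : Fin v → ℝ) (A : Fin v → Matrix (Fin n) (Fin n) ℝ) : Prop :=
  (∀ i, 0 ≤ α i) ∧ (∑ i, α i) = 1 ∧
    (∀ i j k, 0 ≤ A i j k ∧ A i j k ≤ W i j k)

/-- Truncating a negative real to `0` brings it no further from a nonnegative real. -/
theorem sub_max_zero_sq_le {a : ℝ} (ha : 0 ≤ a) (s : ℝ) : (a - max s 0) ^ 2 ≤ (a - s) ^ 2 := by
  rcases le_total s 0 with h | h
  · rw [max_eq_right h]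
    nlinarith [mul_nonneg ha (neg_nonneg.mpr h), sq_nonneg s]
  · rw [max_eq_left h]

/-- Truncating a negative real to `0` brings it strictly closer to a nonnegative real. -/
theorem sub_max_zero_sq_lt {a s : ℝ} (ha : 0 ≤ a) (hs : s < 0) :
    (a - max s 0) ^ 2 < (a - s) ^ 2 := by
  rw [max_eq_right hs.le]
  nlinarith [mul_nonneg ha (neg_nonneg.mpr hs.le), sq_pos_of_neg hs]

/-- If a feasible point has some negative entry `S p q < 0`, then replacing
every negative entry of `S` by `0` strictly decreases the objective. -/
theorem truncating_negative_entries_decreases_objf (n v : ℕ) (hn : 0 < n) (hv : 0 < v)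
    (W : Fin v → Matrix (Fin n) (Fin n) ℝ) (hW : ∀ i j k, 0 ≤ W i j k)
    (lam : Fin v → ℝ) (hlam : ∀ i, 0 < lam i) (β γ : ℝ)
    (α : Fin v → ℝ) (A : Fin v → Matrix (Fin n) (Fin n) ℝ)
    (S : Matrix (Fin n) (Fin n) ℝ)
    (hfeas : feasible n v W α A)
    (hneg : ∃ p q, S p q < 0) :
    objf n v W lam β γ α A (Matrix.of fun j k => max (S j k) 0)
      < objf n v W lam β γ α A S := by
  obtain ⟨hα, -, hA⟩ := hfeas
  obtain ⟨p, q, hpq⟩ := hneg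
  have hαA (i j k) : 0 ≤ α i * A i j k := mul_nonneg (hα i) (hA i j k).1
  have : Nonempty (Fin v) := ⟨⟨0, hv⟩⟩
  unfold objf
  refine add_lt_add_left (Finset.sum_lt_sum_of_nonempty Finset.univ_nonempty fun i _ =>
    mul_lt_mul_of_pos_left ?_ (hlam i)) _
  simp only [Matrix.of_apply]
  exact Finset.sum_lt_sum
    (fun j _ => Finset.sum_le_sum fun k _ => sub_max_zero_sq_le (hαA i j k) _)
    ⟨p, Finset.mem_univ p, Finset.sum_lt_sum
      (fun k _ => sub_max_zero_sq_le (hαA i p k) _)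
      ⟨q, Finset.mem_univ q, sub_max_zero_sq_lt (hαA i p q) hpq⟩⟩
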